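/- Let Γ be a finite simple graph. In A(Γ), the intersection of two parabolic subgroups is again a parabolic subgroup. -/

import Mathlib

universe u

/-- The defining relators of the right-angled Artin group of a simple graph. -/
def raagRels {V : Type u} (Γ : SimpleGraph V) : Set (FreeGroup V) :=
  {r | ∃ u v : V, Γ.Adj u v ∧
    r = FreeGroup.of u * FreeGroup.of v * (FreeGroup.of u)⁻¹ * (FreeGroup.of v)⁻¹}

/-- The right-angled Artin group of a simple graph. -/
abbrev RAAG {V : Type u} (Γ : SimpleGraph V) : Type u := PresentedGroup (raagRels Γ)

/-- The generator of `RAAG Γ` corresponding to a vertex. -/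
def raagGen {V : Type u} (Γ : SimpleGraph V) (u : V) : RAAG Γ :=
  PresentedGroup.of (rels := raagRels Γ) u

/-- A subgroup of `A(Γ)` is parabolic if it is conjugate to the subgroup generated by
the vertices of an induced subgraph of `Γ`. -/
def IsParabolic {V : Type u} (Γ : SimpleGraph V) (H : Subgroup (RAAG Γ)) : Prop :=
  ∃ (S : Set V) (g : RAAG Γ),
    H = Subgroup.map (MulAut.conj g).toMonoidHom (Subgroup.closure (raagGen Γ '' S))

open scoped Pointwise

theorem Subgroup.mem_conj_smul_iff {G : Type*} [Group G] {g x : G} {H : Subgroup G} :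
    x ∈ MulAut.conj g • H ↔ g⁻¹ * x * g ∈ H := by
  rw [Subgroup.mem_pointwise_smul_iff_inv_smul_mem, ← map_inv, MulAut.smul_def,
    MulAut.conj_apply, inv_inv]

namespace HNNExtension

open NormalWord

variable {G : Type*} [Group G]

/-- The element of an HNN extension spelled by a list of syllables `t ^ u * g`. -/
def syllableProd {A B : Subgroup G} (φ : A ≃* B) (l : List (ℤˣ × G)) : HNNExtension G A B φ :=
  (l.map fun x => t ^ (x.1 : ℤ) * of x.2).prod

/-- Multiplying a nonempty reduced list of syllables on the right by an element of the base group
gives a reduced list with the same exponents. -/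
theorem exists_syllableProd_mul_of {A B : Subgroup G} (φ : A ≃* B) (y : G) :
    ∀ l : List (ℤˣ × G), l ≠ [] →
      l.IsChain (fun a b => a.2 ∈ toSubgroup A B a.1 → a.1 = b.1) →
      ∃ l' : List (ℤˣ × G), l'.IsChain (fun a b => a.2 ∈ toSubgroup A B a.1 → a.1 = b.1) ∧
        l'.map Prod.fst = l.map Prod.fst ∧
        syllableProd φ l' = syllableProd φ l * of y
  | [], h, _ => absurd rfl h
  | [(u, g)], _, _ => ⟨[(u, g * y)], by simp, by simp, by simp [syllableProd, mul_assoc]⟩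
  | (u, g) :: (u₂, g₂) :: l, _, hc => by
    rw [List.isChain_cons_cons] at hc
    obtain ⟨l', hl', hfst, hprod⟩ := exists_syllableProd_mul_of φ y _ (by simp) hc.2
    refine ⟨(u, g) :: l', ?_, by simp [hfst], ?_⟩
    · cases l' with
      | nil => simp
      | cons b l' =>
        simp only [List.map_cons, List.cons.injEq] at hfst
        rw [List.isChain_cons_cons]
        exact ⟨fun h => by rw [hfst.1]; exact hc.1 h, hl'⟩
    · simp only [syllableProd, List.map_cons, List.prod_cons] at hprod ⊢
      rw [hprod]
      simp only [mul_assoc]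

theorem mem_comap_of_conj_range {A B : Subgroup G} {φ : A ≃* B} {h : HNNExtension G A B φ}
    {x : G} : x ∈ (MulAut.conj h • (of : G →* HNNExtension G A B φ).range).comap of ↔
      ∃ y, of y = h⁻¹ * of x * h := by
  rw [Subgroup.mem_comap, Subgroup.mem_conj_smul_iff, MonoidHom.mem_range]

theorem comap_of_conj_of_mul_range {A B : Subgroup G} {φ : A ≃* B} (a : G)
    (h : HNNExtension G A B φ) :
    (MulAut.conj (of a * h) • (of : G →* HNNExtension G A B φ).range).comap of =
      MulAut.conj a • (MulAut.conj h • (of : G →* HNNExtension G A B φ).range).comap of := by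
  ext x
  rw [Subgroup.mem_conj_smul_iff, mem_comap_of_conj_range, mem_comap_of_conj_range]
  simp [mul_assoc]

theorem commute_of_zpow_t {A : Subgroup G} {x : G} (hx : x ∈ A) (n : ℤ) :
    Commute (of x : HNNExtension G A A (MulEquiv.refl A)) (t ^ n) :=
  Commute.zpow_right (t_mul_of (φ := MulEquiv.refl A) ⟨x, hx⟩).symm n

theorem comap_of_conj_syllableProd_cons {A : Subgroup G} {u : ℤˣ} {g : G} {l : List (ℤˣ × G)}
    (hc : ((u, g) :: l).IsChain (fun a b => a.2 ∈ toSubgroup A A a.1 → a.1 = b.1)) :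
    (MulAut.conj (syllableProd (MulEquiv.refl A) ((u, g) :: l)) •
        (of : G →* HNNExtension G A A (MulEquiv.refl A)).range).comap of =
      A ⊓ (MulAut.conj (of g * syllableProd (MulEquiv.refl A) l) •
        (of : G →* HNNExtension G A A (MulEquiv.refl A)).range).comap of := by
  have hcons : syllableProd (MulEquiv.refl A) ((u, g) :: l) =
      t ^ (u : ℤ) * (of g * syllableProd (MulEquiv.refl A) l) := by
    simp [syllableProd, mul_assoc]
  have hconj : ∀ x ∈ A, (syllableProd (MulEquiv.refl A) ((u, g) :: l))⁻¹ * of x *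
      syllableProd (MulEquiv.refl A) ((u, g) :: l) =
      (of g * syllableProd (MulEquiv.refl A) l)⁻¹ * of x *
        (of g * syllableProd (MulEquiv.refl A) l) := by
    intro x hx
    have := (commute_of_zpow_t hx (u : ℤ)).eq
    rw [hcons, mul_inv_rev, mul_assoc, mul_assoc, ← mul_assoc (of x), this]
    simp [mul_assoc]
  ext x
  rw [Subgroup.mem_inf, mem_comap_of_conj_range, mem_comap_of_conj_range]
  constructor
  · rintro ⟨y, hy⟩
    suffices hx : x ∈ A from ⟨hx, y, by rw [hy, hconj x hx]⟩
    obtain ⟨l', hl', -, hprod⟩ := exists_syllableProd_mul_of (MulEquiv.refl A) y _ (by simp) hc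
    have key := (ReducedWord.map_fst_eq_and_of_prod_eq (MulEquiv.refl A)
      (w₁ := ⟨x, (u, g) :: l, hc⟩) (w₂ := ⟨1, l', hl'⟩) (by
        change of x * syllableProd _ _ = of 1 * syllableProd _ _
        rw [hprod, hy]
        simp [mul_assoc])).2 u (by simp)
    simpa [toSubgroup] using key
  · rintro ⟨hx, y, hy⟩
    exact ⟨y, by rw [hy, hconj x hx]⟩

/-- In an HNN extension of `G` whose stable letter centralizes `A`, the intersections of `G` with
its conjugates lie in every family of subgroups of `G` that contains `⊤` and `A` and is closed
under intersection and conjugation. -/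
theorem comap_of_conj_range_mem {A : Subgroup G} {P : Set (Subgroup G)} (htop : ⊤ ∈ P)
    (hA : A ∈ P) (hinf : ∀ H ∈ P, ∀ K ∈ P, H ⊓ K ∈ P)
    (hconj : ∀ (g : G), ∀ H ∈ P, MulAut.conj g • H ∈ P)
    (h : HNNExtension G A A (MulEquiv.refl A)) :
    (MulAut.conj h • (of : G →* HNNExtension G A A (MulEquiv.refl A)).range).comap of ∈ P := by
  have hlist : ∀ l : List (ℤˣ × G),
      l.IsChain (fun a b => a.2 ∈ toSubgroup A A a.1 → a.1 = b.1) →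
      (MulAut.conj (syllableProd (MulEquiv.refl A) l) •
        (of : G →* HNNExtension G A A (MulEquiv.refl A)).range).comap of ∈ P := by
    intro l
    induction l with
    | nil =>
      intro _
      convert! htop
      rw [eq_top_iff]
      intro x _
      rw [mem_comap_of_conj_range]
      exact ⟨x, by simp [syllableProd]⟩
    | cons a l ih =>
      intro hc
      rw [comap_of_conj_syllableProd_cons hc, comap_of_conj_of_mul_range]
      exact hinf _ hA _ (hconj _ _ (ih (List.isChain_cons.1 hc).2))
  obtain ⟨d⟩ := TransversalPair.nonempty G A A
  have hw : of (h • (empty : NormalWord d)).head *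
      syllableProd (MulEquiv.refl A) (h • (empty : NormalWord d)).toList = h := by
    have := prod_smul (MulEquiv.refl A) h (empty : NormalWord d)
    rwa [prod_empty, mul_one] at this
  rw [← hw, comap_of_conj_of_mul_range]
  exact hconj _ _ (hlist _ (h • (empty : NormalWord d)).chain)

end HNNExtension

section RAAG

variable {V : Type u} (Γ : SimpleGraph V)

/-- The subgroup of `RAAG Γ` generated by a set of vertices. -/
def stdParabolic (S : Set V) : Subgroup (RAAG Γ) :=
  Subgroup.closure (raagGen Γ '' S)

variable {Γ}

theorem raagGen_mem_stdParabolic {S : Set V} {u : V} (hu : u ∈ S) :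
    raagGen Γ u ∈ stdParabolic Γ S :=
  Subgroup.subset_closure ⟨u, hu, rfl⟩

theorem stdParabolic_mono {S T : Set V} (h : S ⊆ T) : stdParabolic Γ S ≤ stdParabolic Γ T :=
  Subgroup.closure_mono (Set.image_mono h)

theorem stdParabolic_le {S : Set V} {H : Subgroup (RAAG Γ)} (h : ∀ u ∈ S, raagGen Γ u ∈ H) :
    stdParabolic Γ S ≤ H :=
  (Subgroup.closure_le _).2 (by rintro _ ⟨u, hu, rfl⟩; exact h u hu)

theorem stdParabolic_univ : stdParabolic Γ Set.univ = ⊤ := by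
  rw [stdParabolic, Set.image_univ]
  exact PresentedGroup.closure_range_of _

theorem commute_raagGen {u v : V} (h : Γ.Adj u v) : Commute (raagGen Γ u) (raagGen Γ v) := by
  have h1 : PresentedGroup.mk (raagRels Γ) (FreeGroup.of u * FreeGroup.of v *
      (FreeGroup.of u)⁻¹ * (FreeGroup.of v)⁻¹) = 1 :=
    PresentedGroup.one_of_mem ⟨u, v, h, rfl⟩
  simp only [map_mul, map_inv] at h1
  rw [mul_inv_eq_one, mul_inv_eq_iff_eq_mul] at h1
  exact h1

/-- The homomorphism out of `RAAG Γ` determined by images of the vertices such that adjacent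
vertices have commuting images. -/
def raagLift {H : Type*} [Group H] (f : V → H) (hf : ∀ u v, Γ.Adj u v → Commute (f u) (f v)) :
    RAAG Γ →* H :=
  PresentedGroup.toGroup (f := f) (by
    rintro _ ⟨u, v, h, rfl⟩
    simp [(hf u v h).eq])

@[simp]
theorem raagLift_raagGen {H : Type*} [Group H] (f : V → H)
    (hf : ∀ u v, Γ.Adj u v → Commute (f u) (f v)) (u : V) :
    raagLift f hf (raagGen Γ u) = f u :=
  PresentedGroup.toGroup.of _

open scoped Classical in
/-- The retraction of `RAAG Γ` onto the subgroup generated by `S`, killing the other vertices. -/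
noncomputable def raagRetract (S : Set V) : RAAG Γ →* RAAG Γ :=
  raagLift (fun u => if u ∈ S then raagGen Γ u else 1) (by
    intro u v h
    split_ifs <;> simp [commute_raagGen h])

theorem raagRetract_raagGen_of_mem {S : Set V} {u : V} (hu : u ∈ S) :
    raagRetract S (raagGen Γ u) = raagGen Γ u := by
  simp [raagRetract, hu]

theorem raagRetract_raagGen_of_notMem {S : Set V} {u : V} (hu : u ∉ S) :
    raagRetract S (raagGen Γ u) = 1 := by
  simp [raagRetract, hu]

theorem raagRetract_of_mem {S : Set V} {x : RAAG Γ} (hx : x ∈ stdParabolic Γ S) :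
    raagRetract S x = x :=
  stdParabolic_le (H := (raagRetract S).eqLocus (MonoidHom.id _))
    (fun _ hu => raagRetract_raagGen_of_mem hu) hx

theorem raagRetract_mem_of_mem {S T : Set V} {x : RAAG Γ} (hx : x ∈ stdParabolic Γ T) :
    raagRetract S x ∈ stdParabolic Γ (S ∩ T) := by
  refine stdParabolic_le (H := (stdParabolic Γ (S ∩ T)).comap (raagRetract S)) ?_ hx
  intro u hu
  rw [Subgroup.mem_comap]
  by_cases h : u ∈ S
  · rw [raagRetract_raagGen_of_mem h]
    exact raagGen_mem_stdParabolic ⟨h, hu⟩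
  · rw [raagRetract_raagGen_of_notMem h]
    exact one_mem _

theorem raagRetract_mem (S : Set V) (x : RAAG Γ) : raagRetract S x ∈ stdParabolic Γ S := by
  have := raagRetract_mem_of_mem (S := S) (T := Set.univ) (x := x)
    (by rw [stdParabolic_univ]; trivial)
  rwa [Set.inter_univ] at this

theorem raagRetract_mem_conj_smul {S T : Set V} {g x : RAAG Γ}
    (hx : x ∈ MulAut.conj g • stdParabolic Γ T) :
    raagRetract S x ∈ MulAut.conj (raagRetract S g) • stdParabolic Γ (S ∩ T) := by
  rw [Subgroup.mem_conj_smul_iff] at hx ⊢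
  simpa using raagRetract_mem_of_mem (S := S) hx

theorem conj_smul_stdParabolic_le {S T : Set V} {g : RAAG Γ} (hg : g ∈ stdParabolic Γ S)
    (hT : T ⊆ S) : MulAut.conj g • stdParabolic Γ T ≤ stdParabolic Γ S :=
  Subgroup.conj_smul_le_of_le (stdParabolic_mono hT) ⟨g, hg⟩

theorem isParabolic_iff {H : Subgroup (RAAG Γ)} :
    IsParabolic Γ H ↔ ∃ (S : Set V) (g : RAAG Γ), H = MulAut.conj g • stdParabolic Γ S :=
  Iff.rfl

theorem isParabolic_stdParabolic (S : Set V) : IsParabolic Γ (stdParabolic Γ S) :=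
  isParabolic_iff.2 ⟨S, 1, by simp⟩

theorem IsParabolic.conj_smul {H : Subgroup (RAAG Γ)} (h : IsParabolic Γ H) (g : RAAG Γ) :
    IsParabolic Γ (MulAut.conj g • H) := by
  obtain ⟨S, k, rfl⟩ := isParabolic_iff.1 h
  exact isParabolic_iff.2 ⟨S, g * k, by rw [map_mul, mul_smul]⟩

theorem isParabolic_conj_smul_iff {H : Subgroup (RAAG Γ)} {g : RAAG Γ} :
    IsParabolic Γ (MulAut.conj g • H) ↔ IsParabolic Γ H :=
  ⟨fun h => by simpa using h.conj_smul g⁻¹, fun h => h.conj_smul g⟩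

/-- A parabolic subgroup contained in `⟨S⟩` is conjugate by an element of `⟨S⟩` to some `⟨U⟩` with
`U ⊆ S`. -/
theorem IsParabolic.exists_of_le {H : Subgroup (RAAG Γ)} (h : IsParabolic Γ H) {S : Set V}
    (hS : H ≤ stdParabolic Γ S) :
    ∃ U ⊆ S, ∃ g ∈ stdParabolic Γ S, H = MulAut.conj g • stdParabolic Γ U := by
  obtain ⟨T, g, rfl⟩ := isParabolic_iff.1 h
  refine ⟨S ∩ T, Set.inter_subset_left, raagRetract S g, raagRetract_mem S g, le_antisymm ?_ ?_⟩
  · intro x hx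
    rw [← raagRetract_of_mem (hS hx)]
    exact raagRetract_mem_conj_smul hx
  · intro x hx
    have hx' : g * ((raagRetract S g)⁻¹ * x * raagRetract S g) * g⁻¹ ∈
        MulAut.conj g • stdParabolic Γ T := by
      rw [Subgroup.mem_conj_smul_iff] at hx ⊢
      simpa [mul_assoc] using stdParabolic_mono Set.inter_subset_right hx
    have hxS : x ∈ stdParabolic Γ S :=
      conj_smul_stdParabolic_le (raagRetract_mem S g) Set.inter_subset_left hx
    have := raagRetract_of_mem (hS hx')
    rw [map_mul, map_mul, map_mul, map_mul, map_inv, map_inv, raagRetract_of_mem hxS,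
      raagRetract_of_mem (raagRetract_mem S g)] at this
    rw [← this] at hx'
    simpa [mul_assoc] using hx'

section Splitting

variable (Γ) (S : Set V) (v : V)

/-- The splitting of `⟨S⟩` as an HNN extension of `⟨S \ {v}⟩` with stable letter `v`, which
centralizes the subgroup generated by the neighbours of `v`. -/
abbrev RaagHNN : Type _ :=
  HNNExtension (stdParabolic Γ (S \ {v}))
    ((stdParabolic Γ ((S \ {v}) ∩ Γ.neighborSet v)).subgroupOf (stdParabolic Γ (S \ {v})))
    ((stdParabolic Γ ((S \ {v}) ∩ Γ.neighborSet v)).subgroupOf (stdParabolic Γ (S \ {v})))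
    (MulEquiv.refl _)

theorem commute_of_raagGen_t {u : V} (hu : u ∈ S \ {v}) (h : Γ.Adj v u) :
    Commute (HNNExtension.of ⟨raagGen Γ u, raagGen_mem_stdParabolic hu⟩ : RaagHNN Γ S v)
      HNNExtension.t := by
  have := HNNExtension.commute_of_zpow_t
    (A := (stdParabolic Γ ((S \ {v}) ∩ Γ.neighborSet v)).subgroupOf (stdParabolic Γ (S \ {v})))
    (x := ⟨raagGen Γ u, raagGen_mem_stdParabolic hu⟩)
    (Subgroup.mem_subgroupOf.2 (raagGen_mem_stdParabolic ⟨hu, h⟩)) 1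
  rwa [zpow_one] at this

open scoped Classical in
/-- The homomorphism from `RAAG Γ` onto the HNN extension with stable letter `v`, killing the
vertices outside `S`. -/
noncomputable def toRaagHNN : RAAG Γ →* RaagHNN Γ S v :=
  raagLift (fun u => if h : u ∈ S \ {v} then
      HNNExtension.of ⟨raagGen Γ u, raagGen_mem_stdParabolic h⟩
    else if u ∈ S then HNNExtension.t else 1) (by
    intro a b h
    have eq_of : ∀ {c : V}, c ∉ S \ {v} → c ∈ S → c = v := fun h₁ h₂ => by
      by_contra hne
      exact h₁ ⟨h₂, hne⟩
    split_ifs with h₁ h₂ h₃ h₃ h₄ h₅ h₆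
    · have hc : Commute
          (⟨raagGen Γ a, raagGen_mem_stdParabolic h₁⟩ : stdParabolic Γ (S \ {v}))
          ⟨raagGen Γ b, raagGen_mem_stdParabolic h₂⟩ := Subtype.ext (commute_raagGen h).eq
      exact hc.map HNNExtension.of
    · obtain rfl := eq_of h₂ h₃
      exact commute_of_raagGen_t Γ S b h₁ h.symm
    · simp
    · obtain rfl := eq_of h₁ h₃
      exact (commute_of_raagGen_t Γ S a h₄ h).symm
    all_goals simp)

/-- The homomorphism from the HNN extension with stable letter `v` to `RAAG Γ`. -/
def ofRaagHNN : RaagHNN Γ S v →* RAAG Γ :=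
  HNNExtension.lift (stdParabolic Γ (S \ {v})).subtype (raagGen Γ v) (by
    rintro ⟨⟨a, _⟩, ha⟩
    refine stdParabolic_le (H := Subgroup.centralizer {raagGen Γ v}) ?_
      (Subgroup.mem_subgroupOf.1 ha) _ rfl
    rintro u hu _ rfl
    exact (commute_raagGen hu.2).eq)

variable {Γ S v}

theorem toRaagHNN_of_mem (x : stdParabolic Γ (S \ {v})) :
    toRaagHNN Γ S v x = HNNExtension.of x := by
  obtain ⟨x, hx⟩ := x
  induction hx using Subgroup.closure_induction with
  | mem x h =>
    obtain ⟨u, hu, rfl⟩ := h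
    simp only [toRaagHNN, raagLift_raagGen]
    exact dif_pos hu
  | one => rw [map_one]; exact (map_one HNNExtension.of).symm
  | mul x y hx hy ihx ihy =>
    rw [map_mul, ihx, ihy, ← map_mul]
    rfl
  | inv x hx ih =>
    rw [map_inv, ih, ← map_inv]
    rfl

theorem ofRaagHNN_toRaagHNN {x : RAAG Γ} (hx : x ∈ stdParabolic Γ S) :
    ofRaagHNN Γ S v (toRaagHNN Γ S v x) = x := by
  refine stdParabolic_le
    (H := ((ofRaagHNN Γ S v).comp (toRaagHNN Γ S v)).eqLocus (MonoidHom.id _)) ?_ hx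
  intro u hu
  change ofRaagHNN Γ S v (toRaagHNN Γ S v (raagGen Γ u)) = raagGen Γ u
  by_cases h : u = v
  · subst h
    simp [toRaagHNN, hu, ofRaagHNN]
  · have := toRaagHNN_of_mem (Γ := Γ) (S := S) (v := v)
      ⟨raagGen Γ u, raagGen_mem_stdParabolic ⟨hu, h⟩⟩
    rw [this]
    simp [ofRaagHNN]

theorem stdParabolic_inf_conj_smul_eq_map {g : RAAG Γ} (hg : g ∈ stdParabolic Γ S) :
    stdParabolic Γ (S \ {v}) ⊓ MulAut.conj g • stdParabolic Γ (S \ {v}) =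
      ((MulAut.conj (toRaagHNN Γ S v g) •
        (HNNExtension.of : _ →* RaagHNN Γ S v).range).comap HNNExtension.of).map
          (stdParabolic Γ (S \ {v})).subtype := by
  ext x
  rw [Subgroup.mem_inf, Subgroup.mem_conj_smul_iff, Subgroup.mem_map]
  constructor
  · rintro ⟨hx, hgx⟩
    refine ⟨⟨x, hx⟩, HNNExtension.mem_comap_of_conj_range.2 ⟨⟨_, hgx⟩, ?_⟩, rfl⟩
    rw [← toRaagHNN_of_mem, ← toRaagHNN_of_mem]
    simp
  · rintro ⟨x, hx, rfl⟩
    obtain ⟨y, hy⟩ := HNNExtension.mem_comap_of_conj_range.1 hx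
    refine ⟨x.2, ?_⟩
    rw [← toRaagHNN_of_mem, ← toRaagHNN_of_mem, ← map_inv, ← map_mul, ← map_mul] at hy
    have hsub := stdParabolic_mono (Γ := Γ) (Set.sdiff_subset (s := S) (t := {v}))
    have hy' := congrArg (ofRaagHNN Γ S v) hy
    rw [ofRaagHNN_toRaagHNN (hsub y.2), ofRaagHNN_toRaagHNN
      (mul_mem (mul_mem (inv_mem hg) (hsub x.2)) hg)] at hy'
    rw [Subgroup.subtype_apply, ← hy']
    exact y.2

/-- If parabolic subgroups inside `⟨S \ {v}⟩` are closed under intersection, then `⟨S \ {v}⟩` meets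
each of its `⟨S⟩`-conjugates in a parabolic subgroup. -/
theorem isParabolic_stdParabolic_inf_conj_smul
    (ih : ∀ H K : Subgroup (RAAG Γ), IsParabolic Γ H → IsParabolic Γ K →
      H ≤ stdParabolic Γ (S \ {v}) → K ≤ stdParabolic Γ (S \ {v}) → IsParabolic Γ (H ⊓ K))
    {g : RAAG Γ} (hg : g ∈ stdParabolic Γ S) :
    IsParabolic Γ (stdParabolic Γ (S \ {v}) ⊓ MulAut.conj g • stdParabolic Γ (S \ {v})) := by
  rw [stdParabolic_inf_conj_smul_eq_map hg]
  refine HNNExtension.comap_of_conj_range_mem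
    (P := {H | IsParabolic Γ (H.map (stdParabolic Γ (S \ {v})).subtype)}) ?_ ?_ ?_ ?_ _
  · rw [Set.mem_ofPred_eq, ← MonoidHom.range_eq_map, Subgroup.range_subtype]
    exact isParabolic_stdParabolic _
  · rw [Set.mem_ofPred_eq, Subgroup.map_subgroupOf_eq_of_le (stdParabolic_mono
      Set.inter_subset_left)]
    exact isParabolic_stdParabolic _
  · intro H hH K hK
    rw [Set.mem_ofPred_eq, Subgroup.map_inf _ _ _ (Subgroup.subtype_injective _)]
    exact ih _ _ hH hK (Subgroup.map_subtype_le _) (Subgroup.map_subtype_le _)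
  · intro k H hH
    rw [Set.mem_ofPred_eq] at hH ⊢
    convert! hH.conj_smul (k : RAAG Γ) using 1
    ext x
    simp only [Subgroup.mem_conj_smul_iff, Subgroup.mem_map, Subgroup.subtype_apply]
    constructor
    · rintro ⟨y, hy, rfl⟩
      exact ⟨_, hy, by simp⟩
    · rintro ⟨y, hy, hyx⟩
      exact ⟨k * y * k⁻¹, by simpa [mul_assoc] using hy, by simp [hyx, mul_assoc]⟩

end Splitting

theorem isParabolic_inf_of_le [Finite V] (S : Set V) :
    ∀ H K : Subgroup (RAAG Γ), IsParabolic Γ H → IsParabolic Γ K →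
      H ≤ stdParabolic Γ S → K ≤ stdParabolic Γ S → IsParabolic Γ (H ⊓ K) := by
  induction S using WellFoundedLT.induction with
  | ind S ih =>
  have key : ∀ v ∈ S, ∀ U ⊆ S \ {v}, ∀ W ⊆ S \ {v}, ∀ g ∈ stdParabolic Γ S,
      IsParabolic Γ (stdParabolic Γ U ⊓ MulAut.conj g • stdParabolic Γ W) := by
    intro v hv U hU W hW g hg
    have ihv := ih (S \ {v}) (Set.sdiff_singleton_ssubset.2 hv)
    set M := stdParabolic Γ (S \ {v})
    have hUM : stdParabolic Γ U ≤ M := stdParabolic_mono hU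
    have hWM : stdParabolic Γ W ≤ M := stdParabolic_mono hW
    have hQ : IsParabolic Γ (M ⊓ MulAut.conj g • M) :=
      isParabolic_stdParabolic_inf_conj_smul ihv hg
    have hUQ : IsParabolic Γ (stdParabolic Γ U ⊓ (M ⊓ MulAut.conj g • M)) :=
      ihv _ _ (isParabolic_stdParabolic U) hQ hUM inf_le_left
    have hWQ : IsParabolic Γ (MulAut.conj g • stdParabolic Γ W ⊓ (M ⊓ MulAut.conj g • M)) := by
      rw [← isParabolic_conj_smul_iff (g := g⁻¹), Subgroup.smul_inf, map_inv, inv_smul_smul]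
      refine ihv _ _ (isParabolic_stdParabolic W) ?_ hWM ?_
      · rw [← map_inv]
        exact hQ.conj_smul _
      · rw [Subgroup.smul_inf, inv_smul_smul]
        exact inf_le_right
    have hsub : MulAut.conj g • stdParabolic Γ W ≤ MulAut.conj g • M :=
      Subgroup.pointwise_smul_le_pointwise_smul_iff.2 hWM
    convert! ihv _ _ hUQ hWQ (inf_le_left.trans hUM) (inf_le_right.trans inf_le_left) using 1
    refine le_antisymm (le_inf (le_inf inf_le_left ?_) (le_inf inf_le_right ?_))
      (inf_le_inf inf_le_left inf_le_left) <;>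
    exact inf_le_inf hUM hsub
  intro H K hH hK hHS hKS
  obtain ⟨U, hU, h, hh, rfl⟩ := hH.exists_of_le hHS
  obtain ⟨W, hW, k, hk, rfl⟩ := hK.exists_of_le hKS
  rcases hW.eq_or_ssubset with rfl | hWS
  · rwa [Subgroup.conj_smul_eq_self_of_mem hk, inf_eq_left.2 hHS]
  obtain ⟨v, hvS, hvW⟩ := Set.exists_of_ssubset hWS
  have hWv : W ⊆ S \ {v} := fun w hw => ⟨hW hw, fun hwv => hvW (hwv ▸ hw)⟩
  -- Projecting to `⟨U⟩` replaces `⟨U⟩` by a conjugate of `⟨U ∩ W⟩`.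
  have hg : h⁻¹ * k ∈ stdParabolic Γ S := mul_mem (inv_mem hh) hk
  generalize hgk : h⁻¹ * k = g at hg
  obtain rfl : k = h * g := by rw [← hgk]; simp
  rw [map_mul, mul_smul, ← Subgroup.smul_inf, isParabolic_conj_smul_iff]
  have hr : raagRetract U g ∈ stdParabolic Γ U := raagRetract_mem U g
  have hproj : stdParabolic Γ U ⊓ MulAut.conj g • stdParabolic Γ W =
      MulAut.conj (raagRetract U g) • stdParabolic Γ (U ∩ W) ⊓
        MulAut.conj g • stdParabolic Γ W := by
    refine le_antisymm (le_inf ?_ inf_le_right) (inf_le_inf_right _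
      (conj_smul_stdParabolic_le hr Set.inter_subset_left))
    rintro x ⟨hxU, hxW⟩
    rw [← raagRetract_of_mem hxU]
    exact raagRetract_mem_conj_smul hxW
  rw [hproj, ← isParabolic_conj_smul_iff (g := (raagRetract U g)⁻¹), Subgroup.smul_inf,
    ← mul_smul, ← mul_smul, ← map_mul, ← map_mul, inv_mul_cancel, map_one, one_smul]
  exact key v hvS _ (Set.inter_subset_right.trans hWv) _ hWv _
    (mul_mem (inv_mem (stdParabolic_mono hU hr)) hg)

end RAAG

/-- In `A(Γ)`, the intersection of two parabolic subgroups is parabolic. -/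
theorem parabolic_inter {V : Type u} [Fintype V] (Γ : SimpleGraph V)
    (H K : Subgroup (RAAG Γ)) (hH : IsParabolic Γ H) (hK : IsParabolic Γ K) :
    IsParabolic Γ (H ⊓ K) :=
  isParabolic_inf_of_le Set.univ H K hH hK (by simp [stdParabolic_univ])
    (by simp [stdParabolic_univ])
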